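/- There exist ε > 0 and n₀ ∈ ℕ such that the following holds. Suppose H is a 3-uniform hypergraph on n ≥ n₀ vertices and d ≤ n/3 is a positive integer. If δ₁(H) > C(n-1,2) − C(n-d,2) (where C(a,b) denotes the binomial coefficient) and H is ε-close to H_{n,d}, then H contains a matching of size d. -/

import Mathlib

open Finset

section Matching

variable {α : Type*} [DecidableEq α]

theorem matching_insert {H M : Finset (Finset α)} {e : Finset α} (hM : M ⊆ H)
    (hdisj : (M : Set (Finset α)).PairwiseDisjoint id) (he : e ∈ H) (hne : e.Nonempty)
    (heM : Disjoint e (M.biUnion id)) :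
    insert e M ⊆ H ∧ ((insert e M : Finset (Finset α)) : Set (Finset α)).PairwiseDisjoint id ∧
      (insert e M).card = M.card + 1 := by
  rw [disjoint_biUnion_right] at heM
  refine ⟨insert_subset he hM, ?_, card_insert_of_notMem fun h => ?_⟩
  · rw [coe_insert]
    exact hdisj.insert fun f hf _ => heM f hf
  · exact hne.ne_empty (disjoint_self.mp (heM e h))

theorem matching_union {H M N : Finset (Finset α)} (hM : M ⊆ H) (hN : N ⊆ H)
    (hMd : (M : Set (Finset α)).PairwiseDisjoint id)
    (hNd : (N : Set (Finset α)).PairwiseDisjoint id)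
    (hne : ∀ e ∈ N, e.Nonempty) (hNM : ∀ e ∈ N, Disjoint e (M.biUnion id)) :
    M ∪ N ⊆ H ∧ ((M ∪ N : Finset (Finset α)) : Set (Finset α)).PairwiseDisjoint id ∧
      (M ∪ N).card = M.card + N.card := by
  have key : ∀ e ∈ N, ∀ f ∈ M, Disjoint e f := fun e he f hf =>
    (disjoint_biUnion_right _ _ _).mp (hNM e he) f hf
  refine ⟨union_subset hM hN, ?_, card_union_of_disjoint ?_⟩
  · rw [coe_union]
    exact hMd.union hNd fun f hf e he _ => (key e he f hf).symm
  · rw [Finset.disjoint_left]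
    intro e heM heN
    exact (hne e heN).ne_empty (disjoint_self.mp (key e heN e heM))

theorem card_biUnion_le_three_mul {H M : Finset (Finset α)} (hM : M ⊆ H)
    (h3 : ∀ e ∈ H, e.card = 3) : (M.biUnion id).card ≤ 3 * M.card := by
  rw [mul_comm]
  exact card_biUnion_le_card_mul _ _ _ fun e he => (h3 e (hM he)).le

/-- The number of edges through two given vertices. -/
theorem card_codegree_le {H : Finset (Finset α)} {S : Finset α}
    (h3 : ∀ e ∈ H, e.card = 3 ∧ e ⊆ S) {u v : α} (huv : u ≠ v) (hu : u ∈ S) (hv : v ∈ S) :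
    (H.filter fun e => u ∈ e ∧ v ∈ e).card ≤ S.card - 2 := by
  have hsub : ({u, v} : Finset α) ⊆ S := by
    intro x hx
    simp only [mem_insert, mem_singleton] at hx
    rcases hx with rfl | rfl <;> assumption
  have hc : (S \ {u, v}).card = S.card - 2 := by
    rw [card_sdiff_of_subset hsub, card_pair huv]
  rw [← hc]
  refine (card_le_card ?_).trans (card_image_le (f := fun x => ({u, v, x} : Finset α)))
  intro e he
  simp only [mem_filter] at he
  obtain ⟨heH, hue, hve⟩ := he
  have hsub' : ({u, v} : Finset α) ⊆ e := by
    intro x hx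
    simp only [mem_insert, mem_singleton] at hx
    rcases hx with rfl | rfl <;> assumption
  have h1 : (e \ {u, v}).card = 1 := by
    rw [card_sdiff_of_subset hsub', card_pair huv, (h3 e heH).1]
  obtain ⟨x, hx⟩ := card_eq_one.mp h1
  have hxe : x ∈ e \ {u, v} := by simp [hx]
  refine mem_image.mpr ⟨x, ?_, ?_⟩
  · rw [mem_sdiff] at hxe ⊢
    exact ⟨(h3 e heH).2 hxe.1, hxe.2⟩
  · rw [← sdiff_union_of_subset hsub', hx]
    ext y
    simp only [mem_insert, mem_singleton, mem_union]
    tauto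

theorem card_filter_not_disjoint_le {H : Finset (Finset α)} {S U : Finset α}
    (h3 : ∀ e ∈ H, e.card = 3 ∧ e ⊆ S) {v : α} (hv : v ∈ S) (hvU : v ∉ U) :
    (H.filter fun e => v ∈ e ∧ ¬ Disjoint e U).card ≤ U.card * S.card := by
  have hsub : (H.filter fun e => v ∈ e ∧ ¬ Disjoint e U) ⊆
      U.biUnion fun u => H.filter fun e => u ∈ e ∧ v ∈ e := by
    intro e he
    simp only [mem_filter, Finset.not_disjoint_iff] at he
    obtain ⟨heH, hve, u, hue, huU⟩ := he
    simp only [mem_biUnion, mem_filter]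
    exact ⟨u, huU, heH, hue, hve⟩
  refine (card_le_card hsub).trans (card_biUnion_le_card_mul _ _ _ fun u hu => ?_)
  have huv : u ≠ v := fun h => hvU (h ▸ hu)
  by_cases huS : u ∈ S
  · exact (card_codegree_le h3 huv huS hv).trans (Nat.sub_le _ _)
  · rw [filter_eq_empty_iff.mpr]
    · simp
    · exact fun e he h => huS ((h3 e he).2 h.1)

theorem choose_two_add (a b : ℕ) :
    (a + b).choose 2 = a.choose 2 + a * b + b.choose 2 := by
  induction b with
  | zero => simp
  | succ b ih =>
    rw [← add_assoc, Nat.choose_succ_succ' (a + b) 1, Nat.choose_succ_succ' b 1, ih]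
    simp only [Nat.choose_one_right, Nat.reduceAdd]
    ring

theorem sum_card_filter_mem {H : Finset (Finset α)} {S : Finset α}
    (h3 : ∀ e ∈ H, e.card = 3 ∧ e ⊆ S) :
    ∑ v ∈ S, (H.filter fun e => v ∈ e).card = 3 * H.card := by
  simp only [card_filter]
  rw [sum_comm, mul_comm, ← smul_eq_mul, ← sum_const]
  refine sum_congr rfl fun e he => ?_
  rw [← card_filter, filter_mem_eq_inter, inter_eq_right.mpr (h3 e he).2, (h3 e he).1]

/-- The Bollobás–Daykin–Erdős theorem for 3-uniform hypergraphs, for matchings that are small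
compared to the number of vertices. -/
theorem exists_matching_of_small (d : ℕ) : ∀ (S : Finset α) (H : Finset (Finset α)),
    (∀ e ∈ H, e.card = 3 ∧ e ⊆ S) → 28 * d ≤ S.card →
    (∀ v ∈ S, (S.card - 1).choose 2 <
      (H.filter fun e => v ∈ e).card + (S.card - d).choose 2) →
    ∃ M ⊆ H, (M : Set (Finset α)).PairwiseDisjoint id ∧ M.card = d := by
  induction d with
  | zero => exact fun S H _ _ _ => ⟨∅, by simp⟩
  | succ d ih =>
    intro S H h3 hS hdeg
    by_cases hbig : ∃ v ∈ S, 3 * d * S.card < (H.filter fun e => v ∈ e).card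
    · obtain ⟨v, hv, hvdeg⟩ := hbig
      have hcard : (S.erase v).card = S.card - 1 := card_erase_of_mem hv
      obtain ⟨M, hM, hMd, hMc⟩ := ih (S.erase v) (H.filter fun e => v ∉ e)
        (by
          intro e he
          rw [mem_filter] at he
          exact ⟨(h3 e he.1).1, subset_erase.mpr ⟨(h3 e he.1).2, he.2⟩⟩)
        (by omega)
        (by
          intro u hu
          rw [mem_erase] at hu
          have h1 := hdeg u hu.2
          have h2 := card_codegree_le h3 hu.1 hu.2 hv
          have h4 : (H.filter fun e => u ∈ e).card =
              (H.filter fun e => u ∈ e ∧ v ∈ e).card +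
              ((H.filter fun e => v ∉ e).filter fun e => u ∈ e).card := by
            rw [← card_filter_add_card_filter_not (s := H.filter fun e => u ∈ e)
              (fun e => v ∈ e), filter_filter, filter_filter, filter_filter]
            congr 3
            ext e
            exact and_comm
          have h5 := choose_two_add (S.card - 2) 1
          have h6 : S.card - 2 + 1 = S.card - 1 := by omega
          have h7 : S.card - (d + 1) = S.card - 1 - d := by omega
          have h8 : S.card - 1 - 1 = S.card - 2 := by omega
          rw [h6] at h5
          rw [h7] at h1
          rw [hcard, h8]
          simp only [mul_one, Nat.choose_succ_self, add_zero] at h5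
          omega)
      have hMH : M ⊆ H := hM.trans (filter_subset _ _)
      have hvU : v ∉ M.biUnion id := by
        simp only [mem_biUnion, not_exists, not_and]
        exact fun e he => (mem_filter.mp (hM he)).2
      have hlt : (H.filter fun e => v ∈ e ∧ ¬ Disjoint e (M.biUnion id)).card <
          (H.filter fun e => v ∈ e).card := by
        refine (card_filter_not_disjoint_le h3 hv hvU).trans_lt (lt_of_le_of_lt ?_ hvdeg)
        have := card_biUnion_le_three_mul hMH fun e he => (h3 e he).1
        rw [hMc] at this
        gcongr
      obtain ⟨e, he, he'⟩ := exists_mem_notMem_of_card_lt_card hlt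
      rw [mem_filter] at he
      have hdis : Disjoint e (M.biUnion id) := by
        by_contra h
        exact he' (mem_filter.mpr ⟨he.1, he.2, h⟩)
      obtain ⟨h1, h2, h4⟩ := matching_insert hMH hMd he.1 ⟨v, he.2⟩ hdis
      exact ⟨_, h1, h2, by rw [h4, hMc]⟩
    · classical
      push Not at hbig
      have hex : (H.powerset.filter fun M : Finset (Finset α) =>
          (M : Set (Finset α)).PairwiseDisjoint id).Nonempty := ⟨∅, by simp⟩
      obtain ⟨M, hMmem, hmax⟩ := exists_max_image _ card hex
      rw [mem_filter, mem_powerset] at hMmem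
      obtain ⟨hMH, hMd⟩ := hMmem
      by_cases hMc : d + 1 ≤ M.card
      · obtain ⟨N, hN, hNc⟩ := exists_subset_card_eq hMc
        exact ⟨N, hN.trans hMH, hMd.subset (by exact_mod_cast hN), hNc⟩
      exfalso
      have hU := card_biUnion_le_three_mul hMH fun e he => (h3 e he).1
      have hcover : H ⊆ (S ∩ M.biUnion id).biUnion fun u => H.filter fun e => u ∈ e := by
        intro e he
        have hne : e.Nonempty := card_pos.mp (by rw [(h3 e he).1]; norm_num)
        have hnd : ¬ Disjoint e (M.biUnion id) := by
          intro hdis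
          obtain ⟨h1, h2, h4⟩ := matching_insert hMH hMd he hne hdis
          have := hmax (insert e M) (mem_filter.mpr ⟨mem_powerset.mpr h1, h2⟩)
          omega
        obtain ⟨u, hue, huU⟩ := Finset.not_disjoint_iff.mp hnd
        exact mem_biUnion.mpr
          ⟨u, mem_inter.mpr ⟨(h3 e he).2 hue, huU⟩, mem_filter.mpr ⟨he, hue⟩⟩
      have hH : H.card ≤ 3 * d * (3 * d * S.card) := by
        refine (card_le_card hcover).trans ((card_biUnion_le_card_mul _ _ (3 * d * S.card)
          fun u hu => hbig u (mem_inter.mp hu).1).trans ?_)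
        have : (S ∩ M.biUnion id).card ≤ 3 * d :=
          (card_le_card inter_subset_right).trans (by omega)
        gcongr
      have hsum := sum_card_filter_mem h3
      have hlow : S.card * (27 * d * d + 1) ≤ ∑ v ∈ S, (H.filter fun e => v ∈ e).card := by
        rw [← smul_eq_mul, ← sum_const]
        refine sum_le_sum fun v hv => ?_
        have h1 := hdeg v hv
        have h2 := choose_two_add (S.card - (d + 1)) d
        have h4 : S.card - (d + 1) + d = S.card - 1 := by omega
        have h5 : 27 * d * d ≤ (S.card - (d + 1)) * d :=
          Nat.mul_le_mul_right _ (by omega)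
        rw [h4] at h2
        omega
      have hpos : 0 < S.card := by omega
      nlinarith

end Matching

/-- A dense balanced tripartite 3-uniform hypergraph has a perfect matching. -/
theorem exists_perm_of_few_missing {ι : Type*} [Fintype ι] [DecidableEq ι]
    (F : ι → ι → ι → Prop) [∀ i j k, Decidable (F i j k)] (B : ℕ)
    (h₁ : ∀ i, (univ.filter fun p : ι × ι => ¬ F i p.1 p.2).card ≤ B)
    (h₂ : ∀ j, (univ.filter fun p : ι × ι => ¬ F p.1 j p.2).card ≤ B)
    (h₃ : ∀ k, (univ.filter fun p : ι × ι => ¬ F p.1 p.2 k).card ≤ B)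
    (hB : 3 * B + 3 * Fintype.card ι < Fintype.card ι * Fintype.card ι) :
    ∃ σ τ : Equiv.Perm ι, ∀ i, F i (σ i) (τ i) := by
  obtain ⟨⟨σ, τ⟩, hmax⟩ := Finite.exists_max fun q : Equiv.Perm ι × Equiv.Perm ι =>
    (univ.filter fun i => F i (q.1 i) (q.2 i)).card
  refine ⟨σ, τ, ?_⟩
  by_contra hcon
  push Not at hcon
  obtain ⟨i, hi⟩ := hcon
  let X₁ := univ.filter fun p : ι × ι => ¬ F i (σ p.1) (τ p.2)
  let X₂ := univ.filter fun p : ι × ι => ¬ F p.2 (σ i) (τ p.1)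
  let X₃ := univ.filter fun p : ι × ι => ¬ F p.1 (σ p.2) (τ i)
  let Y₁ := univ.image fun k : ι => (i, k)
  let Y₂ := univ.image fun j : ι => (j, i)
  let Y₃ := univ.image fun j : ι => (j, j)
  have hX₁ : X₁.card ≤ B :=
    (card_le_card_of_injOn (fun p => (σ p.1, τ p.2)) (fun p hp => by simpa [X₁] using hp)
      (fun p _ q _ h => by simpa [Prod.ext_iff] using h)).trans (h₁ i)
  have hX₂ : X₂.card ≤ B :=
    (card_le_card_of_injOn (fun p => (p.2, τ p.1)) (fun p hp => by simpa [X₂] using hp)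
      (fun p _ q _ h => by simpa [Prod.ext_iff, and_comm] using h)).trans (h₂ (σ i))
  have hX₃ : X₃.card ≤ B :=
    (card_le_card_of_injOn (fun p => (p.1, σ p.2)) (fun p hp => by simpa [X₃] using hp)
      (fun p _ q _ h => by simpa [Prod.ext_iff] using h)).trans (h₃ (τ i))
  have hY₁ : Y₁.card ≤ Fintype.card ι := card_image_le
  have hY₂ : Y₂.card ≤ Fintype.card ι := card_image_le
  have hY₃ : Y₃.card ≤ Fintype.card ι := card_image_le
  have hlt : (X₁ ∪ X₂ ∪ X₃ ∪ Y₁ ∪ Y₂ ∪ Y₃).card < (univ : Finset (ι × ι)).card := by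
    rw [card_univ, Fintype.card_prod]
    have e1 := card_union_le (X₁ ∪ X₂ ∪ X₃ ∪ Y₁ ∪ Y₂) Y₃
    have e2 := card_union_le (X₁ ∪ X₂ ∪ X₃ ∪ Y₁) Y₂
    have e3 := card_union_le (X₁ ∪ X₂ ∪ X₃) Y₁
    have e4 := card_union_le (X₁ ∪ X₂) X₃
    have e5 := card_union_le X₁ X₂
    omega
  obtain ⟨⟨j, k⟩, -, hjk⟩ := exists_mem_notMem_of_card_lt_card hlt
  simp only [mem_union, not_or, X₁, X₂, X₃, Y₁, Y₂, Y₃, mem_filter, mem_univ, true_and,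
    not_not, mem_image, Prod.mk.injEq, not_exists] at hjk
  obtain ⟨⟨⟨⟨⟨f₁, f₂⟩, f₃⟩, hij⟩, hik⟩, hjk⟩ := hjk
  have hij : i ≠ j := fun h => hij k ⟨h, rfl⟩
  have hik : i ≠ k := fun h => hik j ⟨rfl, h⟩
  have hjk : j ≠ k := fun h => hjk j ⟨rfl, h⟩
  let c : Equiv.Perm ι := Equiv.swap i j * Equiv.swap j k
  have ci : c i = j := by simp [c, Equiv.swap_apply_of_ne_of_ne hij hik]
  have cj : c j = k := by simp [c, Equiv.swap_apply_of_ne_of_ne hik.symm hjk.symm]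
  have ck : c k = i := by simp [c]
  have co : ∀ x, x ≠ i → x ≠ j → x ≠ k → c x = x := fun x h1 h2 h3 => by
    simp [c, Equiv.swap_apply_of_ne_of_ne h2 h3, Equiv.swap_apply_of_ne_of_ne h1 h2]
  have inv : ∀ {x y}, c x = y → c⁻¹ y = x := fun {x y} h => by simp [← h]
  have hnew := hmax (σ * c, τ * c⁻¹)
  refine absurd hnew (not_le.mpr (card_lt_card (ssubset_iff_of_subset ?_ |>.mpr ⟨i, ?_, ?_⟩)))
  · intro x hx
    rw [mem_filter] at hx ⊢
    refine ⟨mem_univ x, ?_⟩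
    replace hx := hx.2
    simp only [Equiv.Perm.mul_apply]
    by_cases hxi : x = i
    · subst hxi
      exact absurd hx hi
    by_cases hxj : x = j
    · subst hxj
      rwa [cj, inv ci]
    by_cases hxk : x = k
    · subst hxk
      rwa [ck, inv cj]
    · have := co x hxi hxj hxk
      rwa [inv this, this]
  · rw [mem_filter]
    refine ⟨mem_univ i, ?_⟩
    simp only [Equiv.Perm.mul_apply]
    rwa [ci, inv ck]
  · simpa using hi

section Cover

variable {α : Type*} [DecidableEq α]

theorem card_sdiff_union_add {W e U : Finset α} (h : Disjoint e U) :
    (W \ (e ∪ U)).card + (e ∩ W).card = (W \ U).card := by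
  rw [← card_union_of_disjoint]
  · congr 1
    ext x
    have : x ∈ e → x ∉ U := fun hx => Finset.disjoint_left.mp h hx
    simp only [mem_union, mem_sdiff, mem_inter]
    tauto
  · rw [Finset.disjoint_left]
    intro x
    simp only [mem_union, mem_sdiff, mem_inter]
    tauto

/-- Greedily extends a matching so that it covers `B`, while the size of the matching plus the
number of uncovered vertices of `W` stays constant. -/
theorem exists_matching_cover {H M₁ : Finset (Finset α)} {W : Finset α} {d s : ℕ}
    (h3 : ∀ e ∈ H, e.card = 3) (hM₁ : M₁ ⊆ H)
    (hM₁d : (M₁ : Set (Finset α)).PairwiseDisjoint id)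
    (hd : M₁.card + (W \ M₁.biUnion id).card = d)
    (hbal : ∀ U : Finset α, U.card ≤ s → ∃ f ∈ H, Disjoint f U ∧ (f ∩ W).card = 2)
    (B : Finset α) (hs : 3 * (M₁.card + 2 * B.card) + 3 ≤ s)
    (hcov : ∀ v ∈ B, ∀ U : Finset α, U.card ≤ s → v ∉ U →
      ∃ e ∈ H, v ∈ e ∧ Disjoint e U ∧ (e ∩ W).card ≤ 1) :
    ∃ M ⊆ H, (M : Set (Finset α)).PairwiseDisjoint id ∧ B ⊆ M.biUnion id ∧
      M.card + (W \ M.biUnion id).card = d ∧ M.card ≤ M₁.card + 2 * B.card := by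
  induction B using Finset.induction_on with
  | empty => exact ⟨M₁, hM₁, hM₁d, empty_subset _, hd, by simp⟩
  | insert v B hvB ih =>
    rw [card_insert_of_notMem hvB] at hs ⊢
    obtain ⟨M, hM, hMd, hBM, hMW, hMc⟩ :=
      ih (by omega) fun u hu => hcov u (mem_insert_of_mem hu)
    by_cases hvM : v ∈ M.biUnion id
    · exact ⟨M, hM, hMd, insert_subset hvM hBM, hMW, by omega⟩
    have hU := card_biUnion_le_three_mul hM h3
    obtain ⟨e, he, hve, heU, heW⟩ := hcov v (mem_insert_self _ _) (M.biUnion id) (by omega) hvM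
    obtain ⟨hM', hMd', hMc'⟩ := matching_insert hM hMd he ⟨v, hve⟩ heU
    have hU' : (insert e M).biUnion id = e ∪ M.biUnion id := by simp [biUnion_insert]
    have hW' := card_sdiff_union_add (W := W) heU
    have hB' : insert v B ⊆ e ∪ M.biUnion id :=
      insert_subset (mem_union_left _ hve) (hBM.trans subset_union_right)
    obtain h0 | h1 : (e ∩ W).card = 0 ∨ (e ∩ W).card = 1 := by omega
    · have hUc := card_biUnion_le_three_mul hM' h3
      obtain ⟨f, hf, hfU, hfW⟩ := hbal ((insert e M).biUnion id) (by omega)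
      obtain ⟨hM'', hMd'', hMc''⟩ := matching_insert hM' hMd' hf
        (card_pos.mp (by rw [h3 f hf]; norm_num)) hfU
      have hU'' : (insert f (insert e M)).biUnion id = f ∪ (insert e M).biUnion id := by
        rw [biUnion_insert, id]
      have hW'' := card_sdiff_union_add (W := W) hfU
      refine ⟨_, hM'', hMd'', ?_, ?_, by omega⟩
      · rw [hU'', hU']
        exact hB'.trans subset_union_right
      · rw [hU'']
        rw [hU'] at hW'' ⊢
        omega
    · refine ⟨_, hM', hMd', by rwa [hU'], ?_, by omega⟩
      rw [hU']
      omega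

/-- Edges through a vertex outside `W` whose other two vertices are in `W`. -/
theorem card_filter_two_le {H : Finset (Finset α)} (h3 : ∀ e ∈ H, e.card = 3)
    {W : Finset α} {v : α} (hv : v ∉ W) :
    (H.filter fun e => v ∈ e ∧ 2 ≤ (e ∩ W).card).card ≤ W.card.choose 2 := by
  rw [← card_powersetCard]
  refine card_le_card_of_injOn (fun e => e.erase v) ?_ ?_
  · intro e he
    rw [mem_coe, mem_filter] at he
    obtain ⟨heH, hve, he2⟩ := he
    have hc : (e.erase v).card = 2 := by rw [card_erase_of_mem hve, h3 e heH]
    have hsub : e ∩ W ⊆ e.erase v := fun x hx => by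
      rw [mem_inter] at hx
      exact mem_erase.mpr ⟨fun h => hv (h ▸ hx.2), hx.1⟩
    rw [mem_coe, mem_powersetCard]
    refine ⟨?_, hc⟩
    change e.erase v ⊆ W
    rw [← eq_of_subset_of_card_le hsub (by omega)]
    exact inter_subset_right
  · intro e he f hf hef
    rw [mem_coe, mem_filter] at he hf
    rw [← insert_erase he.2.1, ← insert_erase hf.2.1]
    exact congrArg _ hef

end Cover

section Close

variable {α : Type*} [Fintype α] [DecidableEq α]

theorem card_triples_le {X : Finset (Finset α)} (h3 : ∀ e ∈ X, e.card = 3) :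
    (univ.filter fun t : α × α × α => {t.1, t.2.1, t.2.2} ∈ X).card ≤ 27 * X.card := by
  refine card_le_mul_card_image_of_maps_to
    (f := fun t : α × α × α => ({t.1, t.2.1, t.2.2} : Finset α)) (by simp) 27 fun e he => ?_
  have : (e ×ˢ e ×ˢ e).card = 27 := by simp [card_product, h3 e he]
  rw [← this]
  refine card_le_card fun t ht => ?_
  rw [mem_filter] at ht
  rw [← ht.2]
  simp

/-- Few vertices lie in many triples of `X`. -/
theorem card_bad_mul_le {X : Finset (Finset α)} (h3 : ∀ e ∈ X, e.card = 3) (k N : ℕ) :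
    (univ.filter fun v : α =>
      N < k * (univ.filter fun p : α × α => {v, p.1, p.2} ∈ X).card).card * N ≤
      k * (27 * X.card) := by
  refine le_trans ?_ (Nat.mul_le_mul_left k (card_triples_le h3))
  rw [card_eq_sum_card_fiberwise (f := Prod.fst) (t := (univ : Finset α)) (by simp), mul_sum,
    ← smul_eq_mul, ← sum_const]
  refine (sum_le_sum fun v hv => ?_).trans (sum_le_sum_of_subset (subset_univ _))
  refine (mem_filter.mp hv).2.le.trans (Nat.mul_le_mul_left k ?_)
  refine card_le_card_of_injOn (fun p => (v, p)) (fun p hp => ?_) (fun p _ q _ h => by simpa using h)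
  simpa using hp

/-- If almost all triples with one vertex in `P` and two in `Q` are edges at every vertex, some
matching of such edges covers `P`. -/
theorem exists_matching_of_few_missing {H X : Finset (Finset α)} {P Q : Finset α}
    (hPQ : Disjoint P Q) (hcard : 2 * P.card ≤ Q.card) (B : ℕ)
    (hH : ∀ a ∈ P, ∀ b ∈ Q, ∀ c ∈ Q, b ≠ c → {a, b, c} ∉ X → {a, b, c} ∈ H)
    (hgood : ∀ v ∈ P ∪ Q, (univ.filter fun p : α × α => {v, p.1, p.2} ∈ X).card ≤ B)
    (hB : 3 * B + 3 * P.card < P.card * P.card) :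
    ∃ N ⊆ H, (N : Set (Finset α)).PairwiseDisjoint id ∧ N.card = P.card ∧
      ∀ e ∈ N, e.Nonempty ∧ e ⊆ P ∪ Q := by
  obtain ⟨g⟩ : Nonempty (P ⊕ P ↪ Q) :=
    Function.Embedding.nonempty_of_card_le (by simp; omega)
  let x : P → α := fun i => g (Sum.inl i)
  let y : P → α := fun i => g (Sum.inr i)
  have hx : ∀ i, x i ∈ Q := fun i => (g _).2
  have hy : ∀ i, y i ∈ Q := fun i => (g _).2
  have hxi : Function.Injective x := fun i j h => by
    simpa using g.injective (Subtype.ext h)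
  have hyi : Function.Injective y := fun i j h => by
    simpa using g.injective (Subtype.ext h)
  have hxy : ∀ i j, x i ≠ y j := fun i j h => by
    simpa using g.injective (Subtype.ext h)
  have hPx : ∀ a : P, ∀ b ∈ Q, (a : α) ≠ b := fun a b hb h =>
    Finset.disjoint_left.mp hPQ a.2 (h ▸ hb)
  have hX : ∀ i j k : P, ({(i : α), x j, y k} : Finset α) ∉ H → {(i : α), x j, y k} ∈ X :=
    fun i j k h => by
      by_contra hcon
      exact h (hH i i.2 _ (hx j) _ (hy k) (hxy j k) hcon)
  obtain ⟨σ, τ, hστ⟩ := exists_perm_of_few_missing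
    (fun i j k : P => ({(i : α), x j, y k} : Finset α) ∈ H) B
    (fun i => (card_le_card_of_injOn (fun p => (x p.1, y p.2))
      (fun p hp => by
        have := hX i p.1 p.2 (by simpa using hp)
        simpa using this)
      (fun p _ q _ h => by
        simpa [Prod.ext_iff, hxi.eq_iff, hyi.eq_iff] using h)).trans
        (hgood i (mem_union_left _ i.2)))
    (fun j => (card_le_card_of_injOn (fun p => ((p.1 : α), y p.2))
      (fun p hp => by
        have := hX p.1 j p.2 (by simpa using hp)
        rw [insert_comm] at this
        simpa using this)
      (fun p _ q _ h => by
        simpa [Prod.ext_iff, hyi.eq_iff] using h)).trans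
        (hgood (x j) (mem_union_right _ (hx j))))
    (fun k => (card_le_card_of_injOn (fun p => ((p.1 : α), x p.2))
      (fun p hp => by
        have := hX p.1 p.2 k (by simpa using hp)
        rw [pair_comm, insert_comm] at this
        simpa using this)
      (fun p _ q _ h => by
        simpa [Prod.ext_iff, hxi.eq_iff] using h)).trans
        (hgood (y k) (mem_union_right _ (hy k))))
    (by simpa using hB)
  let E : P → Finset α := fun i => {(i : α), x (σ i), y (τ i)}
  have hE : ∀ i j, i ≠ j → Disjoint (E i) (E j) := by
    intro i j hij
    have h1 : x (σ i) ≠ x (σ j) := fun h => hij (σ.injective (hxi h))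
    have h2 : y (τ i) ≠ y (τ j) := fun h => hij (τ.injective (hyi h))
    have h3 : (i : α) ≠ j := fun h => hij (Subtype.ext h)
    simp only [E, disjoint_insert_left, disjoint_singleton_left, mem_insert, mem_singleton, not_or]
    exact ⟨⟨h3, hPx i _ (hx _), hPx i _ (hy _)⟩, ⟨(hPx j _ (hx _)).symm, h1, hxy _ _⟩,
      (hPx j _ (hy _)).symm, (hxy _ _).symm, h2⟩
  have hne : ∀ i, (E i).Nonempty := fun i => ⟨i, mem_insert_self _ _⟩
  have hinj : Function.Injective E := fun i j h => by
    by_contra hij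
    have := hE i j hij
    rw [← h, disjoint_self] at this
    exact (hne i).ne_empty this
  refine ⟨univ.image E, ?_, ?_, ?_, ?_⟩
  · intro e he
    obtain ⟨i, -, rfl⟩ := mem_image.mp he
    exact hστ i
  · intro e he f hf hef
    simp only [coe_image, coe_univ, Set.image_univ, Set.mem_range] at he hf
    obtain ⟨i, rfl⟩ := he
    obtain ⟨j, rfl⟩ := hf
    exact hE i j fun h => hef (h ▸ rfl)
  · rw [card_image_of_injective _ hinj]
    simp
  · intro e he
    obtain ⟨i, -, rfl⟩ := mem_image.mp he
    refine ⟨hne i, ?_⟩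
    simp only [E, insert_subset_iff, singleton_subset_iff, mem_union]
    exact ⟨Or.inl i.2, Or.inr (hx _), Or.inr (hy _)⟩

/-- Edges through `v` that are not contained in `S`. -/
theorem card_filter_not_subset_le {H : Finset (Finset α)} (h3 : ∀ e ∈ H, e.card = 3)
    {S : Finset α} {v : α} (hv : v ∈ S) :
    (H.filter fun e => v ∈ e ∧ ¬ e ⊆ S).card ≤
      (Fintype.card α - 1).choose 2 - (S.card - 1).choose 2 := by
  have hsub : powersetCard 2 (S.erase v) ⊆ powersetCard 2 (univ.erase v) :=
    powersetCard_mono (erase_subset_erase v (subset_univ S))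
  have hc := card_sdiff_of_subset hsub
  rw [card_powersetCard, card_powersetCard, card_erase_of_mem hv,
    card_erase_of_mem (mem_univ v), card_univ] at hc
  rw [← hc]
  refine card_le_card_of_injOn (fun e => e.erase v) ?_ ?_
  · intro e he
    rw [mem_coe, mem_filter] at he
    rw [mem_coe, mem_sdiff, mem_powersetCard, mem_powersetCard,
      card_erase_of_mem he.2.1, h3 e he.1]
    refine ⟨⟨erase_subset_erase v (subset_univ e), rfl⟩, fun h => he.2.2 ?_⟩
    rw [← insert_erase he.2.1]
    exact insert_subset hv (h.1.trans (erase_subset _ _))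
  · intro e he f hf hef
    rw [mem_coe, mem_filter] at he hf
    rw [← insert_erase he.2.1, ← insert_erase hf.2.1]
    exact congrArg _ hef

end Close

section Extremal

variable {α : Type*} [Fintype α] [DecidableEq α]

/-- A vertex of large degree lies in an edge which avoids a given small set and has at most one
vertex in `W`. -/
theorem exists_edge_card_inter_le_one {H : Finset (Finset α)} (h3 : ∀ e ∈ H, e.card = 3)
    {d : ℕ} (hn : 10 ^ 5 ≤ Fintype.card α) (hdn : 3 * d ≤ Fintype.card α)
    (hlarge : Fintype.card α ≤ 28 * d) {v : α}
    (hdeg : (Fintype.card α - 1).choose 2 - (Fintype.card α - d).choose 2 <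
      (H.filter fun e => v ∈ e).card)
    {W U : Finset α} (hW : W.card ≤ d) (hU : 500 * U.card ≤ Fintype.card α)
    (hvW : v ∉ W) (hvU : v ∉ U) :
    ∃ e ∈ H, v ∈ e ∧ Disjoint e U ∧ (e ∩ W).card ≤ 1 := by
  have h1 := card_filter_not_disjoint_le (fun e he => ⟨h3 e he, subset_univ e⟩)
    (mem_univ v) hvU
  have h2 := card_filter_two_le h3 hvW
  rw [card_univ] at h1
  generalize Fintype.card α = n at *
  have h5 := choose_two_add (n - d) (d - 1)
  have h6 := choose_two_add (d - 1) 1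
  have h7 : n - d + (d - 1) = n - 1 := by omega
  have h8 : d - 1 + 1 = d := by omega
  have h9 : W.card.choose 2 ≤ d.choose 2 := Nat.choose_le_choose 2 (by omega)
  rw [h7] at h5
  rw [h8] at h6
  simp only [mul_one, Nat.choose_succ_self, add_zero] at h6
  have h10 : U.card * n ≤ (n - d - 1) * (d - 1) := by
    have i1 : n ≤ 30 * (d - 1) := by omega
    have i2 : n ≤ 2 * (n - d - 1) := by omega
    have i3 := Nat.mul_le_mul i2 i1
    have i4 : 500 * U.card * n ≤ n * n := Nat.mul_le_mul_right n (by omega)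
    nlinarith only [i3, i4, Nat.zero_le (U.card * n)]
  have h11 : (n - d) * (d - 1) = (n - d - 1) * (d - 1) + (d - 1) := by
    obtain ⟨k, hk⟩ : ∃ k, n - d = k + 1 := ⟨n - d - 1, by omega⟩
    rw [hk, Nat.add_sub_cancel]
    ring
  have hlt : ((H.filter fun e => v ∈ e ∧ ¬ Disjoint e U) ∪
      (H.filter fun e => v ∈ e ∧ 2 ≤ (e ∩ W).card)).card <
      (H.filter fun e => v ∈ e).card := by
    refine (card_union_le _ _).trans_lt ?_
    omega
  obtain ⟨e, he, he'⟩ := exists_mem_notMem_of_card_lt_card hlt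
  rw [mem_filter] at he
  simp only [mem_union, mem_filter, he.1, he.2, true_and, not_or, not_not, not_le] at he'
  exact ⟨e, he.1, he.2, he'.1, by omega⟩

/-- There is an edge with exactly two vertices in `W \ A` which avoids a given small set. -/
theorem exists_edge_card_inter_eq_two {H X : Finset (Finset α)} {W A U : Finset α} {n : ℕ}
    (hXH : ∀ e : Finset α, e.card = 3 → ((e ∩ W).card = 1 ∨ (e ∩ W).card = 2) → e ∉ X → e ∈ H)
    (hn : 10 ^ 5 ≤ n)
    (hgood : ∀ v : α, v ∉ A →
      (univ.filter fun p : α × α => {v, p.1, p.2} ∈ X).card ≤ n ^ 2 / 20000)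
    (hP : n ≤ 30 * ((W \ A) \ U).card) (hQ : n ≤ 2 * (Wᶜ \ U).card) :
    ∃ f ∈ H, Disjoint f U ∧ (f ∩ (W \ A)).card = 2 := by
  obtain ⟨a, ha⟩ : ((W \ A) \ U).Nonempty := card_pos.mp (by omega)
  by_contra! hcon
  have haA : a ∉ A := (mem_sdiff.mp (mem_sdiff.mp ha).1).2
  have hsub : (((W \ A) \ U).erase a) ×ˢ (Wᶜ \ U) ⊆
      univ.filter fun p : α × α => {a, p.1, p.2} ∈ X := by
    rintro ⟨b, c⟩ hbc
    simp only [mem_product, mem_erase, mem_sdiff, mem_compl] at hbc ha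
    obtain ⟨⟨hba, ⟨hbW, hbA⟩, hbU⟩, hcW, hcU⟩ := hbc
    obtain ⟨⟨haW, -⟩, haU⟩ := ha
    have hac : a ≠ c := fun h => hcW (h ▸ haW)
    have hbc : b ≠ c := fun h => hcW (h ▸ hbW)
    rw [mem_filter]
    refine ⟨mem_univ _, ?_⟩
    by_contra hX
    have hi : ({a, b, c} : Finset α) ∩ W = {a, b} := by
      ext x
      simp only [mem_inter, mem_insert, mem_singleton]
      constructor
      · rintro ⟨rfl | rfl | rfl, hx⟩ <;> simp_all
      · rintro (rfl | rfl) <;> simp_all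
    have hi' : ({a, b, c} : Finset α) ∩ (W \ A) = {a, b} := by
      ext x
      simp only [mem_inter, mem_insert, mem_singleton, mem_sdiff]
      constructor
      · rintro ⟨rfl | rfl | rfl, hx⟩ <;> simp_all
      · rintro (rfl | rfl) <;> simp_all
    refine hcon _ (hXH _ (card_eq_three.mpr ⟨a, b, c, hba.symm, hac, hbc, rfl⟩)
      (Or.inr (by rw [hi, card_pair hba.symm])) hX) ?_ (by rw [hi', card_pair hba.symm])
    simp only [disjoint_insert_left, disjoint_singleton_left]
    exact ⟨haU, hbU, hcU⟩
  have h1 := (card_le_card hsub).trans (hgood a haA)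
  rw [card_product, card_erase_of_mem ha, Nat.le_div_iff_mul_le (by norm_num)] at h1
  have h2 : n ≤ 40 * (((W \ A) \ U).card - 1) := by omega
  have h4 := Nat.mul_le_mul h2 hQ
  generalize (Wᶜ \ U).card = q at *
  generalize ((W \ A) \ U).card - 1 = p at *
  nlinarith only [h1, h4, hn]

/-- The case where `d` is linear in the number of vertices; `X` is the set of missing edges. -/
theorem exists_matching_of_large_of_close {H X : Finset (Finset α)} {W : Finset α} {d : ℕ}
    (hn : 10 ^ 5 ≤ Fintype.card α) (hdn : 3 * d ≤ Fintype.card α)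
    (hlarge : Fintype.card α ≤ 28 * d) (h3 : ∀ e ∈ H, e.card = 3)
    (hdeg : ∀ v : α, (Fintype.card α - 1).choose 2 - (Fintype.card α - d).choose 2 <
      (H.filter fun e => v ∈ e).card)
    (hW : W.card = d) (hX3 : ∀ e ∈ X, e.card = 3) (hXc : 10 ^ 10 * X.card ≤ Fintype.card α ^ 3)
    (hXH : ∀ e : Finset α, e.card = 3 → ((e ∩ W).card = 1 ∨ (e ∩ W).card = 2) → e ∉ X → e ∈ H) :
    ∃ M ⊆ H, (M : Set (Finset α)).PairwiseDisjoint id ∧ M.card = d := by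
  have hbad := card_bad_mul_le hX3 20000 (Fintype.card α ^ 2)
  have hgood : ∀ v : α, v ∉ (univ.filter fun v : α => Fintype.card α ^ 2 <
      20000 * (univ.filter fun p : α × α => {v, p.1, p.2} ∈ X).card) →
      (univ.filter fun p : α × α => {v, p.1, p.2} ∈ X).card ≤ Fintype.card α ^ 2 / 20000 := by
    intro v hv
    rw [mem_filter] at hv
    rw [Nat.le_div_iff_mul_le (by norm_num)]
    have := not_lt.mp fun h => hv ⟨mem_univ v, h⟩
    omega
  generalize (univ.filter fun v : α => Fintype.card α ^ 2 <
      20000 * (univ.filter fun p : α × α => {v, p.1, p.2} ∈ X).card) = A at hbad hgood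
  generalize hnn : Fintype.card α = n at *
  have hA : 10 ^ 4 * A.card ≤ n := by
    have h1 : (10 ^ 4 * A.card) * n ^ 2 ≤ n * n ^ 2 := by nlinarith
    exact Nat.le_of_mul_le_mul_right h1 (by positivity)
  -- a matching outside `W \ A` replacing the bad vertices of `W`
  have hWA := card_sdiff_add_card_inter W A
  have hcA : (W ∩ A).card ≤ A.card := card_le_card inter_subset_right
  have hS : ((W \ A)ᶜ).card = n - (W \ A).card := by rw [card_compl, hnn]
  have hmono : (n - d).choose 2 ≤ (n - 1).choose 2 := Nat.choose_le_choose 2 (by omega)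
  obtain ⟨M₁, hM₁, hM₁d, hM₁c⟩ := exists_matching_of_small (W ∩ A).card (W \ A)ᶜ
    (H.filter fun e => e ⊆ (W \ A)ᶜ)
    (fun e he => ⟨h3 e (mem_filter.mp he).1, (mem_filter.mp he).2⟩) (by omega) (by
      intro v hv
      have h1 := hdeg v
      have h2 := card_filter_not_subset_le h3 hv
      have h4 : (H.filter fun e => v ∈ e).card =
          ((H.filter fun e => e ⊆ (W \ A)ᶜ).filter fun e => v ∈ e).card +
          (H.filter fun e => v ∈ e ∧ ¬ e ⊆ (W \ A)ᶜ).card := by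
        rw [← card_filter_add_card_filter_not (s := H.filter fun e => v ∈ e)
          (fun e => e ⊆ (W \ A)ᶜ), filter_filter, filter_filter, filter_filter]
        congr 3
        ext e
        exact and_comm
      have h5 : ((W \ A)ᶜ).card - (W ∩ A).card = n - d := by omega
      have h6 : (((W \ A)ᶜ).card - 1).choose 2 ≤ (n - 1).choose 2 :=
        Nat.choose_le_choose 2 (by omega)
      rw [hnn] at h2
      rw [h5]
      omega)
  have hM₁H : M₁ ⊆ H := hM₁.trans (filter_subset _ _)
  have hM₁W : (W \ A) \ M₁.biUnion id = W \ A := by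
    refine sdiff_eq_self_of_disjoint ?_
    rw [disjoint_biUnion_right]
    exact fun e he => (disjoint_compl_right (a := W \ A)).mono_right (mem_filter.mp (hM₁ he)).2
  -- a matching covering all bad vertices
  obtain ⟨M, hM, hMd, hAM, hMW, hMc⟩ := exists_matching_cover (W := W \ A) (d := d)
    (s := 3 * (M₁.card + 2 * A.card) + 3) h3 hM₁H hM₁d (by rw [hM₁W]; omega)
    (fun U hU => exists_edge_card_inter_eq_two (n := n) hXH (A := A) (by omega) hgood
      (by
        have := le_card_sdiff U (W \ A)
        omega)
      (by
        have h1 := le_card_sdiff U Wᶜ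
        rw [card_compl, hnn] at h1
        omega))
    A le_rfl (fun v hv U hU hvU => exists_edge_card_inter_le_one (d := d) h3 (by omega) (by omega)
      (by omega) (by simpa only [hnn] using hdeg v) (by omega) (by omega)
      (fun h => (mem_sdiff.mp h).2 hv) hvU)
  -- the remaining vertices are all good
  have hUc := card_biUnion_le_three_mul hM h3
  have hdisj : Disjoint ((W \ A) \ M.biUnion id) (((W \ A) ∪ M.biUnion id)ᶜ) :=
    disjoint_compl_right.mono_left (sdiff_subset.trans subset_union_left)
  have hQ : (((W \ A) ∪ M.biUnion id)ᶜ).card =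
      n - (((W \ A) \ M.biUnion id).card + (M.biUnion id).card) := by
    rw [card_compl, hnn, ← card_sdiff_add_card]
  have hP : n ≤ 30 * ((W \ A) \ M.biUnion id).card := by omega
  obtain ⟨N, hN, hNd, hNc, hNs⟩ := exists_matching_of_few_missing (H := H) (X := X) hdisj
    (by omega) (n ^ 2 / 20000)
    (by
      intro a ha b hb c hc hbc hX
      simp only [mem_sdiff] at ha
      simp only [mem_compl, mem_union, not_or, mem_sdiff, not_and, not_not] at hb hc
      have hbW : b ∉ W := fun h => hb.2 (hAM (hb.1 h))
      have hcW : c ∉ W := fun h => hc.2 (hAM (hc.1 h))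
      have hab : a ≠ b := fun h => hbW (h ▸ ha.1.1)
      have hac : a ≠ c := fun h => hcW (h ▸ ha.1.1)
      have hi : ({a, b, c} : Finset α) ∩ W = {a} := by
        ext x
        simp only [mem_inter, mem_insert, mem_singleton]
        constructor
        · rintro ⟨rfl | rfl | rfl, hx⟩ <;> simp_all
        · rintro rfl
          exact ⟨Or.inl rfl, ha.1.1⟩
      exact hXH _ (card_eq_three.mpr ⟨a, b, c, hab, hac, hbc, rfl⟩)
        (Or.inl (by rw [hi, card_singleton])) hX)
    (by
      intro v hv
      refine hgood v fun hvA => ?_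
      have := hAM hvA
      simp only [mem_union, mem_sdiff, mem_compl] at hv
      tauto)
    (by
      have h1 := Nat.div_mul_le_self (n ^ 2) 20000
      have h2 := Nat.mul_le_mul hP hP
      nlinarith)
  obtain ⟨h1, h2, h4⟩ := matching_union hM hN hMd hNd (fun e he => (hNs e he).1) (by
    intro e he
    refine Disjoint.mono_left (hNs e he).2 (disjoint_union_left.mpr ⟨sdiff_disjoint, ?_⟩)
    exact (disjoint_compl_left (a := (W \ A) ∪ M.biUnion id)).mono_right subset_union_right)
  exact ⟨_, h1, h2, by omega⟩

end Extremal

/-- extremal case. There exist `ε > 0` and `n₀` such that every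
3-uniform hypergraph `H` on `n ≥ n₀` vertices, with `1 ≤ d ≤ n/3`, minimum vertex degree
greater than `C(n-1,2) - C(n-d,2)`, which is `ε`-close to `H_{n,d}` (i.e. for some
partition `V, W` of the vertex set with `|W| = d`, all but at most `εn³` edges of
`H_{n,d}(V,W)` are edges of `H`), contains a matching of size `d`. -/
theorem stmt_9 :
    ∃ ε : ℝ, 0 < ε ∧ ∃ n₀ : ℕ,
      ∀ (Vt : Type) [Fintype Vt] [DecidableEq Vt] (H : Finset (Finset Vt)) (d : ℕ),
      (∀ e ∈ H, e.card = 3) →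
      n₀ ≤ Fintype.card Vt →
      0 < d → 3 * d ≤ Fintype.card Vt →
      (∀ v : Vt, Nat.choose (Fintype.card Vt - 1) 2 - Nat.choose (Fintype.card Vt - d) 2
        < (H.filter fun e => v ∈ e).card) →
      (∃ W : Finset Vt, W.card = d ∧
        (((((Finset.univ : Finset (Finset Vt)).filter fun e =>
            e.card = 3 ∧ ((e ∩ W).card = 1 ∨ (e ∩ W).card = 2)) \ H).card : ℝ)
          ≤ ε * (Fintype.card Vt : ℝ)^3)) →
      ∃ M ⊆ H, (M : Set (Finset Vt)).PairwiseDisjoint id ∧ M.card = d := by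
  refine ⟨1 / 10 ^ 10, by norm_num, 10 ^ 5, ?_⟩
  rintro Vt _ _ H d h3 hn hd hdn hdeg ⟨W, hW, hclose⟩
  by_cases hsmall : 28 * d ≤ Fintype.card Vt
  · refine exists_matching_of_small d univ H (fun e he => ⟨h3 e he, subset_univ e⟩)
      (by rwa [card_univ]) fun v _ => ?_
    have := hdeg v
    rw [card_univ]
    omega
  refine exists_matching_of_large_of_close hn hdn (by omega) h3 hdeg hW
    (X := ((Finset.univ : Finset (Finset Vt)).filter fun e =>
      e.card = 3 ∧ ((e ∩ W).card = 1 ∨ (e ∩ W).card = 2)) \ H) ?_ ?_ ?_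
  · intro e he
    exact (mem_filter.mp (mem_sdiff.mp he).1).2.1
  · have : (10 : ℝ) ^ 10 * (((univ : Finset (Finset Vt)).filter fun e =>
        e.card = 3 ∧ ((e ∩ W).card = 1 ∨ (e ∩ W).card = 2)) \ H).card ≤
        (Fintype.card Vt : ℝ) ^ 3 := by linarith
    exact_mod_cast this
  · intro e he heW heX
    by_contra heH
    exact heX (mem_sdiff.mpr ⟨mem_filter.mpr ⟨mem_univ e, he, heW⟩, heH⟩)
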